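/- Suppose the positive integer sequences (m_k), (n_k) satisfy Keane's conditions, that \bar A_{m_1,n_1}\cdots\bar A_{m_k,n_k}(e_3) converges as k → ∞ to a vector L, and that there exist a real number r ≥ 1 and N ∈ ℕ such that n_{k+1} ≥ (b_{k,2})^r 2^(rk) m_k for all k ≥ N. Then for every k ≥ N and every vector w ∈ ℝ⁴ with nonnegative entries satisfying B_k w = L, one has w_2 ≤ 1/((b_{k,2})^r 2^(rk)). -/

import Mathlib

open MeasureTheory Filter Set Matrix Topology

noncomputable section

/-- Keane's 4×4 matrix `A_{m,n}` with rows (0,0,1,1), (m−1,m,0,0), (n,n,n−1,n), (1,1,1,1). -/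
def Amat (m n : ℕ) : Matrix (Fin 4) (Fin 4) ℝ :=
  !![0, 0, 1, 1;
     (m : ℝ) - 1, (m : ℝ), 0, 0;
     (n : ℝ), (n : ℝ), (n : ℝ) - 1, (n : ℝ);
     1, 1, 1, 1]

/-- `B_k = A_{m_1,n_1} A_{m_2,n_2} ⋯ A_{m_k,n_k}` (sequences indexed from 1). -/
def Bmat (m n : ℕ → ℕ) (k : ℕ) : Matrix (Fin 4) (Fin 4) ℝ :=
  ((List.range k).map fun i => Amat (m (i + 1)) (n (i + 1))).prod

/-- `|v|₁`, the sum of the absolute values of the entries of `v`. -/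
def l1norm (v : Fin 4 → ℝ) : ℝ := ∑ i, |v i|

/-- `b_{k,i} = |B_k e_i|₁`; here columns are indexed from 0, so `e_i` is the
basis vector with a 1 in position `i` where `i : Fin 4` (e.g. the paper's `e_2` is `i = 1`). -/
def bnum (m n : ℕ → ℕ) (k : ℕ) (i : Fin 4) : ℝ := l1norm fun j => Bmat m n k j i

/-- `Ā_{m,n}(v) = A_{m,n} v / |A_{m,n} v|₁`. -/
def Abar (m n : ℕ) (v : Fin 4 → ℝ) : Fin 4 → ℝ :=
  (l1norm (Amat m n *ᵥ v))⁻¹ • (Amat m n *ᵥ v)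

/-- `barSeq m n k v = Ā_{m_1,n_1} Ā_{m_2,n_2} ⋯ Ā_{m_k,n_k} (v)`. -/
def barSeq (m n : ℕ → ℕ) : ℕ → (Fin 4 → ℝ) → Fin 4 → ℝ
  | 0, v => v
  | k + 1, v => barSeq m n k (Abar (m (k + 1)) (n (k + 1)) v)

/-- The paper's `e₂ = (0,1,0,0)ᵀ`. -/
def e2 : Fin 4 → ℝ := ![0, 1, 0, 0]

/-- The paper's `e₃ = (0,0,1,0)ᵀ`. -/
def e3 : Fin 4 → ℝ := ![0, 0, 1, 0]

/-- Keane's conditions: the sequences are positive integers, `3(n_k+1) ≤ m_k ≤ (n_{k+1}+1)/2`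
for all `k ≥ 1`, and `n_1 ≥ 10`. -/
def KeaneCond (m n : ℕ → ℕ) : Prop :=
  (∀ k, 1 ≤ k → 1 ≤ m k ∧ 1 ≤ n k) ∧
  (∀ k, 1 ≤ k → 3 * (n k + 1) ≤ m k ∧ 2 * m k ≤ n (k + 1) + 1) ∧
  10 ≤ n 1

/-- The permutation (4213) (one-indexed: π(1)=4, π(2)=2, π(3)=1, π(4)=3), written zero-indexed. -/
def kperm : Fin 4 → Fin 4 := ![3, 1, 0, 2]

/-- The 4-interval exchange transformation with length vector `l` and permutation (4213):
on `I_j = [l_1+⋯+l_{j−1}, l_1+⋯+l_j)` it is `x ↦ x − ∑_{k<j} l_k + ∑_{π(k')<π(j)} l_{k'}`. -/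
def iet (l : Fin 4 → ℝ) (x : ℝ) : ℝ :=
  if x < l 0 then
    x + ∑ k ∈ Finset.univ.filter (fun k => kperm k < kperm 0), l k
  else if x < l 0 + l 1 then
    x - l 0 + ∑ k ∈ Finset.univ.filter (fun k => kperm k < kperm 1), l k
  else if x < l 0 + l 1 + l 2 then
    x - (l 0 + l 1) + ∑ k ∈ Finset.univ.filter (fun k => kperm k < kperm 2), l k
  else
    x - (l 0 + l 1 + l 2) + ∑ k ∈ Finset.univ.filter (fun k => kperm k < kperm 3), l k

/-- The IET regarded as a self-map of `ℝ`, extended by the identity off `[0,1)`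
(a measure `μ` with `μ [0,1) = 1` then plays the role of a Borel measure on `[0,1)`). -/
def ietFull (l : Fin 4 → ℝ) (x : ℝ) : ℝ :=
  if x ∈ Set.Ico (0 : ℝ) 1 then iet l x else x

lemma Amat_mulVec (m n : ℕ) (v : Fin 4 → ℝ) :
    Amat m n *ᵥ v = ![v 2 + v 3, ((m : ℝ) - 1) * v 0 + m * v 1,
      n * v 0 + n * v 1 + ((n : ℝ) - 1) * v 2 + n * v 3, v 0 + v 1 + v 2 + v 3] := by
  ext i
  fin_cases i <;> simp [Amat, Matrix.mulVec, dotProduct, Fin.sum_univ_four]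

lemma Amat_det (m n : ℕ) : (Amat m n).det = 1 := by
  simp [Amat, Matrix.det_succ_row_zero, Fin.sum_univ_succ, Fin.succAbove]
  ring

lemma Bmat_zero (m n : ℕ → ℕ) : Bmat m n 0 = 1 := by simp [Bmat]

lemma Bmat_succ (m n : ℕ → ℕ) (k : ℕ) :
    Bmat m n (k + 1) = Bmat m n k * Amat (m (k + 1)) (n (k + 1)) := by
  simp [Bmat, List.range_succ]

lemma isUnit_Bmat_det (m n : ℕ → ℕ) (k : ℕ) : IsUnit (Bmat m n k).det := by
  induction k with
  | zero => simp [Bmat_zero]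
  | succ k ih => simpa [Bmat_succ, Amat_det] using ih

lemma l1norm_smul (c : ℝ) (v : Fin 4 → ℝ) : l1norm (c • v) = |c| * l1norm v := by
  simp [l1norm, abs_mul, Finset.mul_sum]

lemma l1norm_nonneg (v : Fin 4 → ℝ) : 0 ≤ l1norm v :=
  Finset.sum_nonneg fun _ _ => abs_nonneg _

lemma abs_le_l1norm (v : Fin 4 → ℝ) (i : Fin 4) : |v i| ≤ l1norm v :=
  Finset.single_le_sum (f := fun i => |v i|) (fun _ _ => abs_nonneg _) (Finset.mem_univ i)

lemma l1norm_Abar_le (m n : ℕ) (v : Fin 4 → ℝ) : l1norm (Abar m n v) ≤ 1 := by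
  rw [Abar, l1norm_smul, abs_of_nonneg (inv_nonneg.2 (l1norm_nonneg _))]
  exact inv_mul_le_one

lemma l1norm_barSeq_le (m n : ℕ → ℕ) (k : ℕ) (v : Fin 4 → ℝ) (hv : l1norm v ≤ 1) :
    l1norm (barSeq m n k v) ≤ 1 := by
  induction k generalizing v with
  | zero => exact hv
  | succ k ih => exact ih _ (l1norm_Abar_le _ _ _)

lemma barSeq_eq_smul (m n : ℕ → ℕ) (k : ℕ) (v : Fin 4 → ℝ) :
    ∃ c : ℝ, 0 ≤ c ∧ barSeq m n k v = Bmat m n k *ᵥ (c • v) := by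
  induction k generalizing v with
  | zero => exact ⟨1, zero_le_one, by simp [barSeq, Bmat_zero]⟩
  | succ k ih =>
    obtain ⟨c, hc, h⟩ := ih (Abar (m (k + 1)) (n (k + 1)) v)
    refine ⟨c * (l1norm (Amat (m (k + 1)) (n (k + 1)) *ᵥ v))⁻¹,
      mul_nonneg hc (inv_nonneg.2 (l1norm_nonneg _)), ?_⟩
    rw [barSeq, h, Bmat_succ, Abar, ← Matrix.mulVec_mulVec, Matrix.mulVec_smul _ _ v, mul_smul]

/-- Multiplication by `A_{m,n}` preserves nonnegativity. -/
lemma Amat_mulVec_nonneg {m n : ℕ} (hm : 1 ≤ m) (hn : 1 ≤ n) {v : Fin 4 → ℝ}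
    (hv : ∀ i, 0 ≤ v i) (i : Fin 4) : 0 ≤ (Amat m n *ᵥ v) i := by
  have hm' : (0 : ℝ) ≤ m - 1 := by simpa using hm
  have hn' : (0 : ℝ) ≤ n - 1 := by simpa using hn
  have h0 := hv 0
  have h1 := hv 1
  have h2 := hv 2
  have h3 := hv 3
  rw [Amat_mulVec]
  fin_cases i <;> simp <;> positivity

lemma l1norm_le_l1norm_Amat {m n : ℕ} (hm : 1 ≤ m) (hn : 1 ≤ n) {v : Fin 4 → ℝ}
    (hv : ∀ i, 0 ≤ v i) : l1norm v ≤ l1norm (Amat m n *ᵥ v) := by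
  refine le_trans ?_ (abs_le_l1norm (Amat m n *ᵥ v) 3)
  rw [abs_of_nonneg (Amat_mulVec_nonneg hm hn hv 3)]
  simp [l1norm, Fin.sum_univ_four, Amat_mulVec, abs_of_nonneg (hv _)]

lemma l1norm_le_l1norm_Bmat {m n : ℕ → ℕ} (hpos : ∀ k, 1 ≤ k → 1 ≤ m k ∧ 1 ≤ n k) (k : ℕ)
    {v : Fin 4 → ℝ} (hv : ∀ i, 0 ≤ v i) : l1norm v ≤ l1norm (Bmat m n k *ᵥ v) := by
  induction k generalizing v with
  | zero => simp [Bmat_zero]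
  | succ k ih =>
    obtain ⟨hm, hn⟩ := hpos (k + 1) (by omega)
    rw [Bmat_succ, ← Matrix.mulVec_mulVec]
    exact (l1norm_le_l1norm_Amat hm hn hv).trans (ih (Amat_mulVec_nonneg hm hn hv))

lemma one_le_bnum {m n : ℕ → ℕ} (hpos : ∀ k, 1 ≤ k → 1 ≤ m k ∧ 1 ≤ n k) (k : ℕ) (i : Fin 4) :
    1 ≤ bnum m n k i := by
  have h := l1norm_le_l1norm_Bmat hpos k (v := Pi.single i 1) fun j => by
    by_cases hj : j = i <;> simp [hj]
  have h1 : (1 : ℝ) ≤ l1norm (Pi.single i 1) := by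
    simpa using abs_le_l1norm (Pi.single i 1) i
  rw [Matrix.mulVec_single_one] at h
  exact h1.trans h

/-- The nonnegative vectors whose first two entries are small, by a factor `3 / n`, compared
with the third one. -/
def thirdCone (n : ℕ) : Set (Fin 4 → ℝ) :=
  {v | (∀ i, 0 ≤ v i) ∧ n * (v 0 + v 1) ≤ 3 * v 2}

lemma isClosed_thirdCone (n : ℕ) : IsClosed (thirdCone n) := by
  have h : IsClosed {v : Fin 4 → ℝ | ∀ i, 0 ≤ v i} := by
    simp only [Set.ofPred_forall]
    exact isClosed_iInter fun i => isClosed_le continuous_const (continuous_apply i)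
  have h' : IsClosed {v : Fin 4 → ℝ | n * (v 0 + v 1) ≤ 3 * v 2} :=
    isClosed_le (by fun_prop) (by fun_prop)
  exact h.inter h'

lemma e3_mem_thirdCone (n : ℕ) : e3 ∈ thirdCone n := by
  refine ⟨fun i => ?_, ?_⟩
  · fin_cases i <;> simp [e3]
  · simp [e3]

lemma smul_mem_thirdCone {n : ℕ} {c : ℝ} (hc : 0 ≤ c) {v : Fin 4 → ℝ} (hv : v ∈ thirdCone n) :
    c • v ∈ thirdCone n := by
  refine ⟨fun i => mul_nonneg hc (hv.1 i), ?_⟩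
  have := mul_le_mul_of_nonneg_left hv.2 hc
  simp only [Pi.smul_apply, smul_eq_mul]
  linarith

lemma Amat_mulVec_mem_thirdCone {m n n' : ℕ} (hm : 1 ≤ m) (hn : 10 ≤ n) (hn' : 10 ≤ n')
    (hmn : 2 * m ≤ n' + 1) {v : Fin 4 → ℝ} (hv : v ∈ thirdCone n') :
    Amat m n *ᵥ v ∈ thirdCone n := by
  refine ⟨Amat_mulVec_nonneg hm (by omega) hv.1, ?_⟩
  obtain ⟨hv, h⟩ := hv
  have h0 := hv 0
  have h1 := hv 1
  have h2 := hv 2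
  have h3 := hv 3
  have hnR : (10 : ℝ) ≤ n := by exact_mod_cast hn
  have hnR' : (10 : ℝ) ≤ n' := by exact_mod_cast hn'
  have hmnR : 2 * (m : ℝ) ≤ n' + 1 := by exact_mod_cast hmn
  have hs : m * (v 0 + v 1) ≤ 1.65 * v 2 := by
    have g1 := mul_le_mul_of_nonneg_right hmnR (add_nonneg h0 h1)
    have g2 := mul_le_mul_of_nonneg_right hnR' (add_nonneg h0 h1)
    linarith
  have g3 : v 2 + v 3 + ((m - 1) * v 0 + m * v 1) ≤ 2.65 * v 2 + v 3 := by linarith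
  have g4 := mul_le_mul_of_nonneg_left g3 (by positivity : (0 : ℝ) ≤ n)
  have g5 := mul_le_mul_of_nonneg_right hnR h2
  have p0 : 0 ≤ n * v 0 := by positivity
  have p1 : 0 ≤ n * v 1 := by positivity
  have p3 : 0 ≤ n * v 3 := by positivity
  simp [Amat_mulVec]
  linarith

lemma KeaneCond.ten_le {m n : ℕ → ℕ} (hK : KeaneCond m n) (k : ℕ) : 10 ≤ n (k + 1) := by
  induction k with
  | zero => exact hK.2.2
  | succ k ih =>
    have := hK.2.1 (k + 1) (by omega)
    omega

lemma KeaneCond.barSeq_mem {m n : ℕ → ℕ} (hK : KeaneCond m n) (k d : ℕ) {v : Fin 4 → ℝ}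
    (hv : v ∈ thirdCone (n (k + d + 1))) :
    ∃ x ∈ thirdCone (n (k + 1)), barSeq m n (k + d) v = Bmat m n k *ᵥ x := by
  induction d generalizing v with
  | zero =>
    obtain ⟨c, hc, h⟩ := barSeq_eq_smul m n k v
    exact ⟨c • v, smul_mem_thirdCone hc hv, h⟩
  | succ d ih =>
    refine ih (v := Abar _ _ v) (smul_mem_thirdCone (inv_nonneg.2 (l1norm_nonneg _)) ?_)
    exact Amat_mulVec_mem_thirdCone (hK.1 _ (by omega)).1 (hK.ten_le _) (hK.ten_le _)
      (hK.2.1 (k + d + 1) (by omega)).2 hv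

lemma KeaneCond.mem_thirdCone {m n : ℕ → ℕ} (hK : KeaneCond m n) {L : Fin 4 → ℝ}
    (hconv : Tendsto (fun k => barSeq m n k e3) atTop (𝓝 L)) {k : ℕ} {w : Fin 4 → ℝ}
    (hw : Bmat m n k *ᵥ w = L) : w ∈ thirdCone (n (k + 1)) := by
  have hinv (x : Fin 4 → ℝ) : (Bmat m n k)⁻¹ *ᵥ (Bmat m n k *ᵥ x) = x := by
    rw [Matrix.mulVec_mulVec, Matrix.nonsing_inv_mul _ (isUnit_Bmat_det m n k),
      Matrix.one_mulVec]
  have hcont : Continuous fun v : Fin 4 → ℝ => (Bmat m n k)⁻¹ *ᵥ v := by fun_prop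
  have hlim := (hcont.tendsto L).comp hconv
  rw [← hw, hinv] at hlim
  refine (isClosed_thirdCone _).mem_of_tendsto hlim ?_
  filter_upwards [eventually_ge_atTop k] with j hj
  obtain ⟨d, rfl⟩ := Nat.exists_eq_add_of_le hj
  obtain ⟨x, hx, h⟩ := hK.barSeq_mem k d (e3_mem_thirdCone _)
  simpa [h, hinv] using hx

lemma l1norm_le_one_of_tendsto {m n : ℕ → ℕ} {L : Fin 4 → ℝ}
    (hconv : Tendsto (fun k => barSeq m n k e3) atTop (𝓝 L)) : l1norm L ≤ 1 := by
  have hcont : Continuous l1norm := by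
    unfold l1norm
    fun_prop
  refine le_of_tendsto ((hcont.tendsto L).comp hconv) (Eventually.of_forall fun k => ?_)
  exact l1norm_barSeq_le m n k e3 (by simp [l1norm, e3, Fin.sum_univ_four])

/-- Under the conditions of Theorem 2 (namely `n_{k+1} ≥ (b_{k,2})^r 2^{rk} m_k` for `k ≥ N`),
if `B_k w = L` with `w ≥ 0`, then `w₂ ≤ 1/((b_{k,2})^r 2^{rk})` for all `k ≥ N`. -/
theorem lambda3_I2_small (m n : ℕ → ℕ) (hK : KeaneCond m n)
    (L : Fin 4 → ℝ)
    (hconv : Tendsto (fun k => barSeq m n k e3) atTop (𝓝 L))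
    (r : ℝ) (hr : 1 ≤ r) (N : ℕ)
    (hgrow : ∀ k, N ≤ k →
      bnum m n k 1 ^ r * (2 : ℝ) ^ (r * (k : ℝ)) * (m k : ℝ) ≤ (n (k + 1) : ℝ)) :
    ∀ k, N ≤ k → ∀ w : Fin 4 → ℝ, (∀ i, 0 ≤ w i) → Bmat m n k *ᵥ w = L →
      w 1 ≤ 1 / (bnum m n k 1 ^ r * (2 : ℝ) ^ (r * (k : ℝ))) := by
  intro k hk w hw0 hw
  have hle (i : Fin 4) : w i ≤ 1 := calc
    w i ≤ |w i| := le_abs_self _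
    _ ≤ l1norm w := abs_le_l1norm w i
    _ ≤ l1norm L := hw ▸ l1norm_le_l1norm_Bmat hK.1 k hw0
    _ ≤ 1 := l1norm_le_one_of_tendsto hconv
  have hb : 0 < bnum m n k 1 := zero_lt_one.trans_le (one_le_bnum hK.1 k 1)
  rcases Nat.eq_zero_or_pos k with rfl | hkpos
  · have hb1 : bnum m n 0 1 = 1 := by
      simp [bnum, l1norm, Bmat_zero, Fin.sum_univ_four, Matrix.one_apply]
    simpa [hb1] using hle 1
  have hg := hgrow k hk
  set C := bnum m n k 1 ^ r * (2 : ℝ) ^ (r * (k : ℝ))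
  have hCpos : 0 < C := by positivity
  have hcone := (hK.mem_thirdCone hconv hw).2
  have hm : (3 : ℝ) ≤ m k := by
    have := (hK.2.1 k hkpos).1
    exact_mod_cast (by omega : 3 ≤ m k)
  rw [le_div_iff₀ hCpos]
  have h1 := mul_le_mul_of_nonneg_right hg (hw0 1)
  have h2 := mul_le_mul_of_nonneg_left hm (mul_nonneg hCpos.le (hw0 1))
  have h3 : 0 ≤ n (k + 1) * w 0 := mul_nonneg (Nat.cast_nonneg _) (hw0 0)
  linarith [hle 2]
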